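/- Let A be a commutative ring, M an A-module, and for f ∈ A let λ_f be multiplication by f. For a differential operator D of order ≤ k on M, define its symbol on exact k-forms by σ(D)(df₁ ⊙ ⋯ ⊙ df_k) := D^{(k)}_{(f₁,…,f_k)}. Then σ(D) is a well-behaved multi-derivation valued in A-linear endomorphisms: the map (f₁,…,f_k) ↦ D^{(k)}_{(f₁,…,f_k)} ∈ End_A(M) is symmetric, A-linear in no argument but a derivation in each argument (D^{(k)}_{(fg, f₂,…,f_k)} = λ_f ∘ D^{(k)}_{(g,f₂,…,f_k)} + λ_g ∘ D^{(k)}_{(f,f₂,…,f_k)}), and D has order ≤ k−1 if and only if σ(D) = 0. -/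

import Mathlib

/-- Multiplication by `f : A` as an additive (`ℤ`-linear) endomorphism of `M`. -/
def lam (A : Type*) [CommRing A] (M : Type*) [AddCommGroup M] [Module A M] (f : A) :
    Module.End ℤ M :=
  (DistribMulAction.toAddMonoidHom M f).toIntLinearMap

/-- `IsDiffOp A k D` : `D` is a differential operator of order `≤ k` on the `A`-module `M`,
defined inductively: order `≤ 0` means `A`-linear, and order `≤ k + 1` means that every
commutator `[D, λ_f]` has order `≤ k`. -/
def IsDiffOp (A : Type*) [CommRing A] {M : Type*} [AddCommGroup M] [Module A M] :
    ℕ → Module.End ℤ M → Prop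
  | 0 => fun D => ∀ (f : A) (m : M), D (f • m) = f • D m
  | k + 1 => fun D => ∀ f : A, IsDiffOp A k (D * lam A M f - lam A M f * D)

/-- Iterated commutator `D^{(j)}_{(f₁,…,f_j)} = [⋯[[D, λ_{f₁}], λ_{f₂}], …, λ_{f_j}]`,
where the list records `(f₁, …, f_j)`. -/
def itComm {A : Type*} [CommRing A] {M : Type*} [AddCommGroup M] [Module A M]
    (D : Module.End ℤ M) : List A → Module.End ℤ M
  | [] => D
  | f :: fs => itComm (D * lam A M f - lam A M f * D) fs

theorem lam_apply' (A : Type*) [CommRing A] (M : Type*) [AddCommGroup M] [Module A M] (f : A)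
    (m : M) : lam A M f m = f • m := rfl

theorem lam_comm' (A : Type*) [CommRing A] (M : Type*) [AddCommGroup M] [Module A M] (f g : A) :
    lam A M f * lam A M g = lam A M g * lam A M f := by
  ext m
  simp only [Module.End.mul_apply, lam_apply']
  exact smul_comm f g m

theorem lam_mul' (A : Type*) [CommRing A] (M : Type*) [AddCommGroup M] [Module A M] (f g : A) :
    lam A M (f * g) = lam A M f * lam A M g := by
  ext m
  simp only [Module.End.mul_apply, lam_apply']
  exact mul_smul f g m

theorem itComm_add' {A : Type*} [CommRing A] {M : Type*} [AddCommGroup M] [Module A M]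
    (l : List A) : ∀ D E : Module.End ℤ M, itComm (D + E) l = itComm D l + itComm E l := by
  induction l with
  | nil => intro D E; rfl
  | cons f fs ih =>
    intro D E
    simp only [itComm]
    rw [← ih]
    congr 1
    noncomm_ring

theorem itComm_lam_mul' {A : Type*} [CommRing A] {M : Type*} [AddCommGroup M] [Module A M]
    (g : A) (l : List A) :
    ∀ D : Module.End ℤ M, itComm (lam A M g * D) l = lam A M g * itComm D l := by
  induction l with
  | nil => intro D; rfl
  | cons f fs ih =>
    intro D
    simp only [itComm]
    rw [← ih]
    congr 1
    rw [mul_sub, ← mul_assoc, ← mul_assoc, ← mul_assoc, lam_comm' A M f g]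

theorem isDiffOp_iff' {A : Type*} [CommRing A] {M : Type*} [AddCommGroup M] [Module A M]
    (k : ℕ) : ∀ D : Module.End ℤ M,
      IsDiffOp A k D ↔ ∀ l : List A, l.length = k + 1 → itComm D l = 0 := by
  induction k with
  | zero =>
    intro D
    constructor
    · intro h l hl
      obtain ⟨f, rfl⟩ := List.length_eq_one_iff.mp hl
      ext m
      exact sub_eq_zero.mpr (h f m)
    · intro h f m
      exact sub_eq_zero.mp (LinearMap.congr_fun (h [f] rfl) m)
  | succ k ih =>
    intro D
    constructor
    · intro h l hl
      cases l with
      | nil => simp at hl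
      | cons f fs => exact (ih _).mp (h f) fs (by simpa using hl)
    · intro h f
      exact (ih _).mpr fun l hl => h (f :: l) (by simp [hl])

theorem itComm_append' {A : Type*} [CommRing A] {M : Type*} [AddCommGroup M] [Module A M]
    (l l' : List A) : ∀ D : Module.End ℤ M, itComm D (l ++ l') = itComm (itComm D l) l' := by
  induction l with
  | nil => intro D; rfl
  | cons f fs ih => intro D; exact ih _

theorem comm_swap' {A : Type*} [CommRing A] {M : Type*} [AddCommGroup M] [Module A M]
    (l : List A) (f g : A) (D : Module.End ℤ M) :
    itComm D (f :: g :: l) = itComm D (g :: f :: l) := by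
  simp only [itComm]
  congr 1
  have h := lam_comm' A M f g
  simp only [sub_mul, mul_sub, mul_assoc]
  rw [h, ← mul_assoc (lam A M g) (lam A M f) D, ← h, mul_assoc]
  abel

/-- The principal symbol of a differential operator `D` of order `≤ k` (`k ≥ 1`):
the map `(f₁,…,f_k) ↦ D^{(k)}_{(f₁,…,f_k)}` takes values in `A`-linear endomorphisms,
is symmetric, is a derivation in each argument, and vanishes identically
iff `D` has order `≤ k − 1`. -/
theorem principal_symbol (A : Type*) [CommRing A] (M : Type*) [AddCommGroup M] [Module A M]
    (k : ℕ) (hk : 1 ≤ k) (D : Module.End ℤ M) (hD : IsDiffOp A k D) :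
    (∀ l : List A, l.length = k → ∀ (f : A) (m : M),
        (itComm D l) (f • m) = f • (itComm D l) m) ∧
    (∀ (l₁ l₂ : List A) (f g : A),
        itComm D (l₁ ++ f :: g :: l₂) = itComm D (l₁ ++ g :: f :: l₂)) ∧
    (∀ (f g : A) (fs : List A), fs.length + 1 = k →
        itComm D ((f * g) :: fs)
          = lam A M f * itComm D (g :: fs) + lam A M g * itComm D (f :: fs)) ∧
    (IsDiffOp A (k - 1) D ↔ ∀ l : List A, l.length = k → itComm D l = 0) := by
  have h0 := (isDiffOp_iff' k D).mp hD
  refine ⟨?_, ?_, ?_, ?_⟩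
  · intro l hl f m
    have h := h0 (l ++ [f]) (by simp [hl])
    rw [itComm_append'] at h
    exact sub_eq_zero.mp (LinearMap.congr_fun h m)
  · intro l₁ l₂ f g
    rw [itComm_append', itComm_append', comm_swap']
  · intro f g fs hfs
    have h := h0 (f :: g :: fs) (by simp [← hfs])
    simp only [itComm] at h ⊢
    rw [← itComm_lam_mul', ← itComm_lam_mul', ← itComm_add', ← add_zero (itComm (_ + _) fs), ← h,
      ← itComm_add']
    congr 1
    rw [lam_mul']
    noncomm_ring
  · obtain ⟨j, rfl⟩ : ∃ j, k = j + 1 := ⟨k - 1, by omega⟩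
    exact isDiffOp_iff' j D
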